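/- arXiv:2409.04448 — 5 statements merged into one kernel-verified Lean document; each statement's English description precedes it below -/
import Mathlib

section
/- Let n, k be natural numbers and let b₁ ≠ b₂ be two vectors in (ZMod 2)^n. Then the number of k×n matrices A over ZMod 2 with A.mulVec b₁ = A.mulVec b₂ equals 2^(k·(n-1)); equivalently, a uniformly random k×n binary matrix A satisfies A.mulVec b₁ = A.mulVec b₂ with probability exactly 2^(-k). -/
/-- Plain Kolmogorov complexity of `x` under decompressor `V`, in `ℕ∞` (`⊤` if no description). -/
noncomputable def plainC (V : List Bool →. List Bool) (x : List Bool) : ℕ∞ :=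
  sInf {m : ℕ∞ | ∃ d : List Bool, x ∈ V d ∧ (d.length : ℕ∞) = m}

/-- Conditional Kolmogorov complexity of `x` given `y` under conditional decompressor `V`. -/
noncomputable def condC (V : List Bool × List Bool →. List Bool) (x y : List Bool) : ℕ∞ :=
  sInf {m : ℕ∞ | ∃ d : List Bool, x ∈ V (d, y) ∧ (d.length : ℕ∞) = m}

/-- `V` is a universal plain decompressor. -/
def PlainUniversal (V : List Bool →. List Bool) : Prop :=
  Partrec V ∧ ∀ W : List Bool →. List Bool, Partrec W →
    ∃ c : ℕ, ∀ x : List Bool, plainC V x ≤ plainC W x + c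

/-- `V` is a universal conditional decompressor. -/
def CondUniversal (V : List Bool × List Bool →. List Bool) : Prop :=
  Partrec V ∧ ∀ W : List Bool × List Bool →. List Bool, Partrec W →
    ∃ c : ℕ, ∀ x y : List Bool, condC V x y ≤ condC W x y + c

/-- Row-major encoding of a `k × n` binary matrix as a binary string (length `n·k`). -/
def encM {k n : ℕ} (A : Matrix (Fin k) (Fin n) (ZMod 2)) : List Bool :=
  (List.finRange k).flatMap fun i => (List.finRange n).map fun j => decide (A i j = 1)

/-- The vector in `(ZMod 2)^n` associated to a binary string (of length `n`). -/
def vecOf (n : ℕ) (s : List Bool) : Fin n → ZMod 2 :=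
  fun i => if s.getD i false then 1 else 0

/-- The binary string (of length `k`) associated to a vector in `(ZMod 2)^k`. -/
def strOf {k : ℕ} (v : Fin k → ZMod 2) : List Bool :=
  List.ofFn fun i => decide (v i = 1)

/-- The partial recursive code associated to a binary string, via the canonical
computable bijection between `List Bool` and `Nat.Partrec.Code`. -/
def codeOf (x : List Bool) : Nat.Partrec.Code :=
  Denumerable.ofNat Nat.Partrec.Code (Encodable.encode x)

/-- The halting set: strings whose associated program halts on the empty input. -/
def Halts (x : List Bool) : Prop := ((codeOf x).eval 0).Dom


/-- Evaluation of matrices at a nonzero vector is surjective. -/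
theorem Matrix.exists_mulVec_eq {K m n : Type*} [Field K] [Fintype n] {b : n → K}
    (hb : b ≠ 0) (v : m → K) : ∃ A : Matrix m n K, A.mulVec b = v := by
  classical
  obtain ⟨j, hj⟩ := Function.ne_iff.mp hb
  refine ⟨Matrix.vecMulVec v (Pi.single j (b j)⁻¹), ?_⟩
  have hj' : b j ≠ 0 := hj
  ext i
  simp [Matrix.vecMulVec_mulVec, hj']

/-- The matrices annihilating a nonzero vector form a subspace of codimension `card m`. -/
theorem Matrix.finrank_ker_mulVecBilin_flip {K m n : Type*} [Field K] [Fintype m] [Fintype n]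
    {b : n → K} (hb : b ≠ 0) :
    Module.finrank K (LinearMap.ker ((Matrix.mulVecBilin K K (m := m)).flip b)) =
      Fintype.card m * (Fintype.card n - 1) := by
  have hrange : LinearMap.range ((Matrix.mulVecBilin K K (m := m)).flip b) = ⊤ :=
    LinearMap.range_eq_top.mpr (Matrix.exists_mulVec_eq hb)
  have h := LinearMap.finrank_range_add_finrank_ker ((Matrix.mulVecBilin K K (m := m)).flip b)
  rw [hrange, finrank_top, Module.finrank_pi, Module.finrank_matrix, Module.finrank_self,
    mul_one] at h
  rw [Nat.mul_sub_one]
  omega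

/-- Fact 1 (hashing): for distinct vectors `b₁ ≠ b₂` in `(ZMod 2)^n`, exactly
`2^(k·(n-1))` of the `2^(k·n)` binary `k × n` matrices satisfy `A b₁ = A b₂`;
i.e. a uniformly random matrix does so with probability exactly `2^(-k)`. -/
theorem count_matrices_collision (n k : ℕ) (b₁ b₂ : Fin n → ZMod 2) (hne : b₁ ≠ b₂) :
    Nat.card {A : Matrix (Fin k) (Fin n) (ZMod 2) // A.mulVec b₁ = A.mulVec b₂} =
      2 ^ (k * (n - 1)) := by
  have hker (A : Matrix (Fin k) (Fin n) (ZMod 2)) : A.mulVec b₁ = A.mulVec b₂ ↔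
      A ∈ LinearMap.ker ((Matrix.mulVecBilin (ZMod 2) (ZMod 2) (m := Fin k)).flip (b₁ - b₂)) := by
    simp [sub_eq_zero]
  rw [Nat.card_congr (Equiv.subtypeEquivRight hker),
    Module.natCard_eq_pow_finrank (K := ZMod 2),
    Matrix.finrank_ker_mulVecBilin_flip (sub_ne_zero.mpr hne)]
  simp
end

section
/- Let n, k be natural numbers with k ≥ 4, let y be a vector in (ZMod 2)^n, and let S be a finite set of vectors in (ZMod 2)^n with |S| ≤ 2^(k-4). Then the number of k×n matrices A over ZMod 2 for which there exists t ∈ S with t ≠ y and A.mulVec t = A.mulVec y is at most 2^(n·k)/16; i.e., for a uniformly random A this event has probability at most 1/16. -/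
/-- Fixing the product of a `k × n` matrix over a finite field with a nonzero vector imposes `k`
independent linear conditions on the matrix. -/
theorem card_mulVec_eq_zero_mul_card_pow_le {F : Type*} [Field F] [Finite F] (n k : ℕ)
    {v : Fin n → F} (hv : v ≠ 0) :
    Nat.card {A : Matrix (Fin k) (Fin n) F // A.mulVec v = 0} * Nat.card F ^ k ≤
      Nat.card F ^ (n * k) := by
  obtain ⟨i, hi⟩ := Function.ne_iff.mp hv
  let f : {A : Matrix (Fin k) (Fin n) F // A.mulVec v = 0} × (Fin k → F) →
      Matrix (Fin k) (Fin n) F := fun p => p.1.1 + Matrix.vecMulVec p.2 (Pi.single i 1)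
  have mulVec_f (p) : (f p).mulVec v = v i • p.2 := by
    simp [f, Matrix.add_mulVec, p.1.2, Matrix.vecMulVec_mulVec]
  have hf : Function.Injective f := by
    rintro ⟨⟨A, hA⟩, w⟩ ⟨⟨B, hB⟩, u⟩ h
    have hwu : v i • w = v i • u := by
      rw [← mulVec_f ⟨⟨A, hA⟩, w⟩, h, mulVec_f]
    obtain rfl : w = u := smul_right_injective _ hi hwu
    simpa [f] using h
  have : Finite (Matrix (Fin k) (Fin n) F) := inferInstanceAs (Finite (Fin k → Fin n → F))
  have h := Nat.card_le_card_of_injective f hf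
  have hM : Nat.card (Matrix (Fin k) (Fin n) F) = Nat.card F ^ (n * k) := by
    change Nat.card (Fin k → Fin n → F) = _
    simp [Nat.card_fun, pow_mul]
  simpa [Nat.card_prod, Nat.card_fun, hM] using h

/-- For a set `S` of at most `2^(k-4)` vectors, the probability (over a uniform
`k × n` binary matrix `A`) that some `t ∈ S`, `t ≠ y`, collides with `y` under `A`
is at most `1/16`. -/
theorem count_matrices_some_collision (n k : ℕ) (hk : 4 ≤ k) (y : Fin n → ZMod 2)
    (S : Finset (Fin n → ZMod 2)) (hS : S.card ≤ 2 ^ (k - 4)) :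
    16 * Nat.card {A : Matrix (Fin k) (Fin n) (ZMod 2) //
        ∃ t ∈ S, t ≠ y ∧ A.mulVec t = A.mulVec y} ≤ 2 ^ (n * k) := by
  classical
  have hsub : {A : Matrix (Fin k) (Fin n) (ZMod 2) | ∃ t ∈ S, t ≠ y ∧ A.mulVec t = A.mulVec y} ⊆
      ⋃ t ∈ S.erase y, {A | A.mulVec (t - y) = 0} := by
    rintro A ⟨t, ht, hty, h⟩
    simp only [Set.mem_iUnion, Finset.mem_erase]
    exact ⟨t, ⟨hty, ht⟩, by simp [Matrix.mulVec_sub, h]⟩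
  have hunion : Nat.card {A : Matrix (Fin k) (Fin n) (ZMod 2) //
      ∃ t ∈ S, t ≠ y ∧ A.mulVec t = A.mulVec y} ≤
      ∑ t ∈ S.erase y, Nat.card {A : Matrix (Fin k) (Fin n) (ZMod 2) // A.mulVec (t - y) = 0} :=
    (Set.ncard_le_ncard hsub (Set.toFinite _)).trans (Finset.set_ncard_biUnion_le _ _)
  refine Nat.le_of_mul_le_mul_right (c := 2 ^ (k - 4)) ?_ (by positivity)
  calc 16 * Nat.card {A : Matrix (Fin k) (Fin n) (ZMod 2) //
        ∃ t ∈ S, t ≠ y ∧ A.mulVec t = A.mulVec y} * 2 ^ (k - 4)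
      = Nat.card {A : Matrix (Fin k) (Fin n) (ZMod 2) //
        ∃ t ∈ S, t ≠ y ∧ A.mulVec t = A.mulVec y} * 2 ^ k := by
        rw [← Nat.sub_add_cancel hk, pow_add, Nat.add_sub_cancel]
        ring
    _ ≤ ∑ t ∈ S.erase y, Nat.card {A : Matrix (Fin k) (Fin n) (ZMod 2) //
        A.mulVec (t - y) = 0} * 2 ^ k := by
        rw [← Finset.sum_mul]
        gcongr
    _ ≤ ∑ t ∈ S.erase y, 2 ^ (n * k) := by
        refine Finset.sum_le_sum fun t ht => ?_
        simpa using card_mulVec_eq_zero_mul_card_pow_le n k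
          (sub_ne_zero.mpr (Finset.ne_of_mem_erase ht))
    _ ≤ 2 ^ (n * k) * 2 ^ (k - 4) := by
        rw [Finset.sum_const, smul_eq_mul, mul_comm]
        gcongr
        exact (Finset.card_erase_le).trans hS
end

section
/- Let V be a universal conditional decompressor. Then there exists a constant c such that for every binary string y and every natural number n, writing s = C_V(y | enc(n)) (assumed finite), one has s − c ≤ C_V(y | enc(n, s)) ≤ s + c. In other words, C_V(y | n, s) = s − O(1) when s = C_V(y|n). -/
theorem Nat.bits_eq_bodd_cons {n : ℕ} (hn : n ≠ 0) : n.bits = n.bodd :: n.div2.bits := by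
  rw [Nat.div2_bits_eq_tail, Nat.bodd_eq_bits_head]
  cases h : n.bits with
  | nil =>
    have := Nat.size_eq_bits_len n
    rw [h, List.length_nil, eq_comm, Nat.size_eq_zero] at this
    exact absurd this hn
  | cons b l => simp

theorem Primrec.nat_bits : Primrec Nat.bits := by
  have hg : Primrec₂ fun (_ : Unit) (l : List (List Bool)) =>
      if l.length = 0 then some [] else (l[l.length.div2]?).map (l.length.bodd :: ·) := by
    have hlen : Primrec fun p : Unit × List (List Bool) => p.2.length :=
      Primrec.list_length.comp Primrec.snd
    refine Primrec.ite (Primrec.eq.comp hlen (Primrec.const 0)) (Primrec.const (some [])) ?_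
    refine Primrec.option_map
      (Primrec.list_getElem?.comp Primrec.snd (Primrec.nat_div2.comp hlen)) ?_
    exact Primrec.list_cons.comp (Primrec.nat_bodd.comp (hlen.comp Primrec.fst)) Primrec.snd
  have h := Primrec.nat_strong_rec (fun (_ : Unit) n => Nat.bits n) hg fun _ n => by
    by_cases hn : n = 0
    · simp [hn]
    · have hlt : n.div2 < n := by
        rw [Nat.div2_val]; omega
      simp [hn, hlt, Nat.bits_eq_bodd_cons hn]
  exact h.comp (Primrec.const ()) Primrec.id

/-- The number whose little-endian binary expansion is a given string. -/
def natOfBits (l : List Bool) : ℕ :=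
  l.foldr (fun b m => 2 * m + cond b 1 0) 0

theorem natOfBits_bits (n : ℕ) : natOfBits n.bits = n := by
  induction n using Nat.strong_induction_on with
  | _ n ih =>
    by_cases hn : n = 0
    · simp [hn, natOfBits]
    · have hlt : n.div2 < n := by
        rw [Nat.div2_val]; omega
      have h := ih _ hlt
      rw [Nat.bits_eq_bodd_cons hn]
      simp only [natOfBits, List.foldr_cons] at h ⊢
      rw [h, add_comm]
      exact Nat.bodd_add_div2 n

theorem primrec_natOfBits : Primrec natOfBits :=
  Primrec.list_foldr Primrec.id (Primrec.const 0) <| Primrec.to₂ <|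
    Primrec.nat_add.comp
      (Primrec.nat_mul.comp (Primrec.const 2) (Primrec.snd.comp Primrec.snd))
      (Primrec.cond (Primrec.fst.comp Primrec.snd) (Primrec.const 1) (Primrec.const 0))

/-- Number of leading `true`s of a string. -/
def leadingTrues (l : List Bool) : ℕ := l.findIdx (!·)

theorem leadingTrues_replicate_append (j : ℕ) (d : List Bool) :
    leadingTrues (List.replicate j true ++ false :: d) = j := by
  induction j with
  | zero => simp [leadingTrues, List.findIdx_cons]
  | succ j ih => simpa [leadingTrues, List.replicate_succ, List.findIdx_cons] using ih

theorem primrec_leadingTrues : Primrec leadingTrues :=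
  Primrec.list_findIdx Primrec.id (Primrec.not.comp Primrec.snd).to₂

/-- The description `d` together with a gap `k`, encoded at an overhead of `k / 2 + 2` bits. -/
def gapEncode (k : ℕ) (d : List Bool) : List Bool :=
  k.bodd :: (List.replicate k.div2 true ++ false :: d)

theorem length_gapEncode (k : ℕ) (d : List Bool) :
    (gapEncode k d).length = d.length + k / 2 + 2 := by
  simp [gapEncode, Nat.div2_val]; omega

/-- The description stored in an output of `gapEncode`. -/
def gapPayload (l : List Bool) : List Bool := l.drop (leadingTrues l.tail + 2)

/-- The gap stored in an output of `gapEncode`. -/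
def gapValue (l : List Bool) : ℕ := 2 * leadingTrues l.tail + cond l.headI 1 0

theorem gapPayload_gapEncode (k : ℕ) (d : List Bool) : gapPayload (gapEncode k d) = d := by
  simp only [gapPayload, gapEncode, List.tail_cons, leadingTrues_replicate_append]
  rw [List.drop_succ_cons, ← List.singleton_append, ← List.append_assoc]
  exact List.drop_left' (by simp)

theorem gapValue_gapEncode (k : ℕ) (d : List Bool) : gapValue (gapEncode k d) = k := by
  simp only [gapValue, gapEncode, List.tail_cons, leadingTrues_replicate_append, List.headI_cons]
  rw [add_comm]
  exact Nat.bodd_add_div2 k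

theorem primrec_gapPayload : Primrec gapPayload :=
  Primrec.list_drop.comp
    (Primrec.nat_add.comp (primrec_leadingTrues.comp Primrec.list_tail) (Primrec.const 2))
    Primrec.id

theorem primrec_gapValue : Primrec gapValue :=
  Primrec.nat_add.comp
    (Primrec.nat_mul.comp (Primrec.const 2) (primrec_leadingTrues.comp Primrec.list_tail))
    (Primrec.cond Primrec.list_headI (Primrec.const 1) (Primrec.const 0))

theorem condC_le_length {V : List Bool × List Bool →. List Bool} {x y d : List Bool}
    (h : x ∈ V (d, y)) : condC V x y ≤ d.length :=
  sInf_le ⟨d, h, rfl⟩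

theorem exists_length_eq_condC {V : List Bool × List Bool →. List Bool} {x y : List Bool}
    (h : condC V x y ≠ ⊤) : ∃ d : List Bool, x ∈ V (d, y) ∧ (d.length : ℕ∞) = condC V x y := by
  refine csInf_mem (s := {m : ℕ∞ | ∃ d : List Bool, x ∈ V (d, y) ∧ (d.length : ℕ∞) = m}) ?_
  by_contra hne
  rw [Set.not_nonempty_iff_eq_empty] at hne
  exact h (by rw [condC, hne, sInf_empty])

/-- Forgetting the second component of a paired condition costs only a constant. -/
theorem condC_pair_le {V : List Bool × List Bool →. List Bool} (hV : CondUniversal V) :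
    ∃ c : ℕ, ∀ (y : List Bool) (n s : ℕ),
      condC V y (Nat.bits (Nat.pair n s)) ≤ condC V y (Nat.bits n) + c := by
  have hf : Primrec fun p : List Bool × List Bool =>
      (p.1, Nat.bits (natOfBits p.2).unpair.1) :=
    Primrec.fst.pair (Primrec.nat_bits.comp
      (Primrec.fst.comp (Primrec.unpair.comp (primrec_natOfBits.comp Primrec.snd))))
  obtain ⟨c, hc⟩ := hV.2 _ (hV.1.comp hf.to_comp)
  refine ⟨c, fun y n s => (hc y _).trans ?_⟩
  simp only [condC, natOfBits_bits, Nat.unpair_pair, le_refl]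

/-- A description relative to `(n, d.length + k)` gives one relative to `n` at an overhead of
`k / 2 + O(1)` bits. -/
theorem condC_le_of_mem_pair {V : List Bool × List Bool →. List Bool} (hV : CondUniversal V) :
    ∃ c : ℕ, ∀ (y d : List Bool) (n k : ℕ),
      y ∈ V (d, Nat.bits (Nat.pair n (d.length + k))) →
      condC V y (Nat.bits n) ≤ (d.length + k / 2 + c : ℕ) := by
  have hp : Primrec fun p : List Bool × List Bool => gapPayload p.1 :=
    primrec_gapPayload.comp Primrec.fst
  have hf : Primrec fun p : List Bool × List Bool => (gapPayload p.1,
      Nat.bits (Nat.pair (natOfBits p.2) ((gapPayload p.1).length + gapValue p.1))) :=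
    hp.pair (Primrec.nat_bits.comp (Primrec₂.natPair.comp
      (primrec_natOfBits.comp Primrec.snd)
      (Primrec.nat_add.comp (Primrec.list_length.comp hp)
        (primrec_gapValue.comp Primrec.fst))))
  obtain ⟨c, hc⟩ := hV.2 _ (hV.1.comp hf.to_comp)
  refine ⟨2 + c, fun y d n k h => (hc y _).trans ?_⟩
  calc _ ≤ ((gapEncode k d).length : ℕ∞) + c := by
        gcongr
        apply condC_le_length
        simpa only [gapPayload_gapEncode, gapValue_gapEncode, natOfBits_bits] using h
    _ = _ := by rw [length_gapEncode, ← add_assoc]; norm_cast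

/-- If `s = C_V(y | n)` then `C_V(y | n, s) = s - O(1)`: for a universal conditional
decompressor `V` there is a constant `c` with `s - c ≤ C_V(y | enc(n, s)) ≤ s + c`. -/
theorem complexity_given_own_value (V : List Bool × List Bool →. List Bool)
    (hV : CondUniversal V) :
    ∃ c : ℕ, ∀ (y : List Bool) (n s : ℕ),
      condC V y (Nat.bits n) = (s : ℕ∞) →
      (s : ℕ∞) ≤ condC V y (Nat.bits (Nat.pair n s)) + c ∧
      condC V y (Nat.bits (Nat.pair n s)) ≤ (s : ℕ∞) + c := by
  obtain ⟨c₁, hc₁⟩ := condC_pair_le hV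
  obtain ⟨c₂, hc₂⟩ := condC_le_of_mem_pair hV
  refine ⟨c₁ + (2 * c₂ + 1), fun y n s hs => ⟨?_, ?_⟩⟩
  · by_cases htop : condC V y (Nat.bits (Nat.pair n s)) = ⊤
    · simp [htop]
    obtain ⟨d, hd, hlen⟩ := exists_length_eq_condC htop
    rw [← hlen]
    norm_cast
    rcases le_total s d.length with hle | hle
    · omega
    · obtain ⟨k, rfl⟩ := Nat.exists_eq_add_of_le hle
      have h := hc₂ y d n k hd
      rw [hs] at h
      norm_cast at h
      omega
  · rw [← hs]
    refine (hc₁ y n s).trans ?_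
    gcongr
    exact Nat.le_add_right _ _
end

section
/- Let V be a universal conditional decompressor, let y be a binary string of length n, and set k = C_V(y | enc(n)) + 5 with k ≥ 4. Then for at least 15/16 of the k×n matrices A over ZMod 2 there is no binary string t of length n with t ≠ y, C_V(t | enc(n)) ≤ k − 5, and A.mulVec t = A.mulVec y (identifying strings of length n with vectors in (ZMod 2)^n). -/
theorem exists_length_le_of_condC_le {V : List Bool × List Bool →. List Bool} {x z : List Bool}
    {m : ℕ} (h : condC V x z ≤ m) : ∃ d : List Bool, x ∈ V (d, z) ∧ d.length ≤ m := by
  have hne : {m : ℕ∞ | ∃ d : List Bool, x ∈ V (d, z) ∧ (d.length : ℕ∞) = m}.Nonempty := by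
    by_contra hempty
    rw [Set.not_nonempty_iff_eq_empty] at hempty
    rw [condC, hempty, sInf_empty] at h
    exact ENat.natCast_ne_top m (top_le_iff.mp h)
  obtain ⟨d, hd, hlen⟩ := csInf_mem hne
  refine ⟨d, hd, ?_⟩
  have h' : (d.length : ℕ∞) ≤ m := hlen.trans_le h
  exact_mod_cast h'

theorem vecOf_injOn {n : ℕ} {s t : List Bool} (hs : s.length = n) (ht : t.length = n)
    (h : vecOf n s = vecOf n t) : s = t := by
  refine List.ext_getElem (hs.trans ht.symm) fun i hi hi' => ?_
  have hc := congrFun h ⟨i, hs ▸ hi⟩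
  simp only [vecOf, List.getD_eq_getElem _ _ hi, List.getD_eq_getElem _ _ hi'] at hc
  revert hc
  cases s[i] <;> cases t[i] <;> simp

theorem card_binary_matrix (n k : ℕ) :
    Nat.card (Matrix (Fin k) (Fin n) (ZMod 2)) = 2 ^ (n * k) := by
  simp [Matrix, ← pow_mul]

theorem card_mulVec_eq_zero_mul_le {n k : ℕ} {v : Fin n → ZMod 2} (hv : v ≠ 0) :
    Fintype.card {A : Matrix (Fin k) (Fin n) (ZMod 2) // A.mulVec v = 0} * 2 ^ k ≤
      2 ^ (n * k) := by
  obtain ⟨j, hj⟩ := Function.ne_iff.mp hv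
  have hinj : Function.Injective
      fun p : {A : Matrix (Fin k) (Fin n) (ZMod 2) // A.mulVec v = 0} × (Fin k → ZMod 2) =>
        p.1.1 + Matrix.vecMulVec p.2 (Pi.single j 1) := by
    rintro ⟨⟨A, hA⟩, w⟩ ⟨⟨B, hB⟩, u⟩ h
    dsimp only at h
    have hwu : w = u := by
      have hm := congrArg (fun M => Matrix.mulVec M v) h
      simp only [Matrix.add_mulVec, hA, hB, zero_add, Matrix.vecMulVec_mulVec,
        single_dotProduct, one_mul] at hm
      funext i
      have hi := congrFun hm i
      simpa using mul_right_cancel₀ hj (by simpa using hi)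
    subst hwu
    simpa using h
  have hle := Fintype.card_le_of_injective _ hinj
  rw [← Nat.card_eq_fintype_card (α := Matrix _ _ _), card_binary_matrix] at hle
  simpa [ZMod.card] using hle

theorem card_bool_tuples_lt (m : ℕ) :
    Fintype.card (Σ i : Fin m, (Fin i → Bool)) < 2 ^ m := by
  simp only [Fintype.card_sigma, Fintype.card_fun, Fintype.card_bool, Fintype.card_fin]
  rw [Fin.sum_univ_eq_sum_range (fun i => 2 ^ i)]
  exact Nat.geomSum_lt le_rfl (by simp)

/-- Union bound: a family of nonzero vectors indexed by `ι` is avoided by the kernels of all but a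
fraction `card ι / 2 ^ k` of the `k × n` matrices. -/
theorem card_exists_mulVec_eq_zero_mul_le {ι : Type*} [Fintype ι] {n k : ℕ}
    (v : ι → Fin n → ZMod 2) :
    Nat.card {A : Matrix (Fin k) (Fin n) (ZMod 2) // ∃ i, v i ≠ 0 ∧ A.mulVec (v i) = 0} * 2 ^ k ≤
      Fintype.card ι * 2 ^ (n * k) := by
  classical
  rw [Nat.card_eq_fintype_card, Fintype.card_subtype]
  have hsub : (Finset.univ.filter fun A : Matrix (Fin k) (Fin n) (ZMod 2) =>
      ∃ i, v i ≠ 0 ∧ A.mulVec (v i) = 0) ⊆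
      Finset.univ.biUnion fun i => Finset.univ.filter fun A => v i ≠ 0 ∧ A.mulVec (v i) = 0 := by
    intro A
    simp
  calc _ ≤ (∑ i, (Finset.univ.filter fun A : Matrix (Fin k) (Fin n) (ZMod 2) =>
          v i ≠ 0 ∧ A.mulVec (v i) = 0).card) * 2 ^ k :=
        Nat.mul_le_mul_right _ ((Finset.card_le_card hsub).trans Finset.card_biUnion_le)
    _ = ∑ i, (Finset.univ.filter fun A : Matrix (Fin k) (Fin n) (ZMod 2) =>
          v i ≠ 0 ∧ A.mulVec (v i) = 0).card * 2 ^ k := Finset.sum_mul ..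
    _ ≤ ∑ _i : ι, 2 ^ (n * k) := by
        refine Finset.sum_le_sum fun i _ => ?_
        by_cases hi : v i = 0
        · simp [hi]
        · simpa [hi, Fintype.card_subtype] using card_mulVec_eq_zero_mul_le (k := k) hi
    _ = _ := by simp

/-- First claim in Lemma 3: with `k = C_V(y | n) + 5`, for at least `15/16` of the
`k × n` binary matrices `A` there is no `t ≠ y` of length `n` with
`C_V(t | n) ≤ k - 5` and `A t = A y`. -/
theorem most_matrices_no_collision (V : List Bool × List Bool →. List Bool)
    (hV : CondUniversal V) (y : List Bool) (n k : ℕ) (hy : y.length = n)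
    (hk4 : 4 ≤ k) (hk : (k : ℕ∞) = condC V y (Nat.bits n) + 5) :
    15 * 2 ^ (n * k) ≤ 16 * Nat.card {A : Matrix (Fin k) (Fin n) (ZMod 2) //
      ¬ ∃ t : List Bool, t.length = n ∧ t ≠ y ∧
          condC V t (Nat.bits n) ≤ ((k - 5 : ℕ) : ℕ∞) ∧
          A.mulVec (vecOf n t) = A.mulVec (vecOf n y)} := by
  classical
  have hk5 : 5 ≤ k := by
    have h5 : ((5 : ℕ) : ℕ∞) ≤ k := by rw [hk]; exact le_add_self
    exact_mod_cast h5
  obtain ⟨m, rfl⟩ := Nat.exists_eq_add_of_le' hk5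
  let v : (Σ i : Fin (m + 1), (Fin i → Bool)) → Fin n → ZMod 2 := fun p =>
    if h : (V (List.ofFn p.2, Nat.bits n)).Dom then
      vecOf n ((V (List.ofFn p.2, Nat.bits n)).get h) - vecOf n y
    else 0
  let P : Matrix (Fin (m + 5)) (Fin n) (ZMod 2) → Prop := fun A =>
    ∃ t : List Bool, t.length = n ∧ t ≠ y ∧
      condC V t (Nat.bits n) ≤ ((m + 5 - 5 : ℕ) : ℕ∞) ∧
      A.mulVec (vecOf n t) = A.mulVec (vecOf n y)
  have hPv : ∀ A, P A → ∃ p, v p ≠ 0 ∧ A.mulVec (v p) = 0 := by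
    rintro A ⟨t, ht, hty, hC, hA⟩
    obtain ⟨d, hd, hdm⟩ := exists_length_le_of_condC_le hC
    have hvp : v ⟨⟨d.length, by omega⟩, d.get⟩ = vecOf n t - vecOf n y := by
      have hd' : t ∈ V (List.ofFn d.get, Nat.bits n) := by rwa [List.ofFn_get]
      obtain ⟨hdom, hget⟩ := hd'
      simp only [v]
      rw [dif_pos hdom, hget]
    refine ⟨⟨⟨d.length, by omega⟩, d.get⟩, ?_, ?_⟩
    · rw [hvp]
      exact sub_ne_zero.mpr fun h => hty (vecOf_injOn ht hy h)
    · rw [hvp, Matrix.mulVec_sub, hA, sub_self]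
  have hbad := card_exists_mulVec_eq_zero_mul_le (k := m + 5) v
  have hle : Nat.card {A // P A} ≤ Nat.card
      {A : Matrix (Fin (m + 5)) (Fin n) (ZMod 2) // ∃ p, v p ≠ 0 ∧ A.mulVec (v p) = 0} :=
    Nat.card_le_card_of_injective (Subtype.map id hPv)
      (Subtype.map_injective _ Function.injective_id)
  have hidx := card_bool_tuples_lt (m + 1)
  have hcompl : Nat.card {A // P A} + Nat.card {A // ¬ P A} = 2 ^ (n * (m + 5)) := by
    rw [← card_binary_matrix]
    simp only [Nat.card_eq_fintype_card]
    rw [Fintype.card_subtype_compl, Nat.add_sub_cancel' (Fintype.card_subtype_le _)]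
  have hbound : Nat.card {A // P A} * 16 ≤ 2 ^ (n * (m + 5)) := by
    refine Nat.le_of_mul_le_mul_left ?_ (Nat.two_pow_pos (m + 1))
    calc 2 ^ (m + 1) * (Nat.card {A // P A} * 16)
        = Nat.card {A // P A} * 2 ^ (m + 5) := by ring
      _ ≤ _ := Nat.mul_le_mul_right _ hle
      _ ≤ _ := hbad
      _ ≤ _ := Nat.mul_le_mul_right _ hidx.le
  change _ ≤ 16 * Nat.card {A // ¬ P A}
  omega
end

section
/- There exist a universal conditional decompressor V and a universal (plain) decompressor U with the following property. Let x be a binary string of length l belonging to the halting set H, let p_l be the l-th prime, n = p_l − 1, and y = x·0^(n−l). Set k = C_V(y | enc(n)) + 5 and assume k < n. Then at least 9/10 of the k×n matrices A over ZMod 2 satisfy both C_U(enc(A)·f) ≥ n·k + k and C_U(enc(A)·f·0⁹) < n·k + k + 9, where f = A.mulVec y viewed as a binary string of length k. -/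
/-- The event, for a `k × n` matrix `A` and vector `y`, that `enc(A)·f` is `U`-random
but `enc(A)·f·0⁹` is not, where `f = A y` viewed as a string of length `k`. -/
def goodA (U : List Bool →. List Bool) {k n : ℕ} (y : Fin n → ZMod 2)
    (A : Matrix (Fin k) (Fin n) (ZMod 2)) : Prop :=
  ((n * k + k : ℕ) : ℕ∞) ≤ plainC U (encM A ++ strOf (A.mulVec y)) ∧
  plainC U (encM A ++ strOf (A.mulVec y) ++ List.replicate 9 false) <
    ((n * k + k + 9 : ℕ) : ℕ∞)

open Nat.Partrec (Code)

namespace KolmogorovXor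

section Computability

/-- All binary strings of length less than `m`. -/
def stringsLt : ℕ → List (List Bool)
  | 0 => []
  | m + 1 => [] :: ((stringsLt m).map (List.cons true) ++ (stringsLt m).map (List.cons false))

theorem mem_stringsLt {m : ℕ} {d : List Bool} : d ∈ stringsLt m ↔ d.length < m := by
  induction m generalizing d with
  | zero => simp [stringsLt]
  | succ m ih =>
    rcases d with _ | ⟨b, d⟩
    · simp [stringsLt]
    · cases b <;> simp [stringsLt, ih]

theorem length_stringsLt (m : ℕ) : (stringsLt m).length + 1 = 2 ^ m := by
  induction m with
  | zero => simp [stringsLt]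
  | succ m ih => simp only [stringsLt, List.length_cons, List.length_append, List.length_map]; omega

theorem nodup_stringsLt (m : ℕ) : (stringsLt m).Nodup := by
  induction m with
  | zero => simp [stringsLt]
  | succ m ih =>
    have h (b : Bool) : Function.Injective (List.cons b) := fun _ _ h => by simpa using h
    simp only [stringsLt, List.nodup_cons, List.nodup_append, (List.nodup_map_iff (h _)).2 ih]
    simp

theorem primrec_stringsLt : Primrec stringsLt := by
  have h (b : Bool) : Primrec fun l : List (List Bool) => l.map (List.cons b) :=
    Primrec.list_map Primrec.id (Primrec.list_cons.comp (Primrec.const b) Primrec.snd).to₂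
  refine (Primrec.nat_rec₁ (f := fun _ l => [] :: (l.map (List.cons true) ++
    l.map (List.cons false))) [] ?_).of_eq fun m => ?_
  · exact (Primrec.list_cons.comp (Primrec.const [])
      (Primrec.list_append.comp ((h true).comp Primrec.snd) ((h false).comp Primrec.snd))).to₂
  · induction m with
    | zero => rfl
    | succ m ih => simp only [stringsLt, ← ih]

/-- The number with binary digits `d`, least significant digit first. -/
def value (d : List Bool) : ℕ := d.foldr (fun b r => Nat.bit b r) 0

theorem value_bits (n : ℕ) : value n.bits = n := by
  induction n using Nat.binaryRec' with
  | zero => simp [value]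
  | bit b n h ih => rw [Nat.bits_append_bit n b h]; exact congrArg (Nat.bit b) ih

theorem exists_value_eq {m i : ℕ} (h : i < 2 ^ m) : ∃ d : List Bool, d.length = m ∧ value d = i := by
  induction m generalizing i with
  | zero => exact ⟨[], rfl, by simp at h; simp [value, h]⟩
  | succ m ih =>
    obtain ⟨d, hd, hv⟩ := @ih (i / 2) (by omega)
    refine ⟨i.bodd :: d, by simp [hd], ?_⟩
    have : value (i.bodd :: d) = Nat.bit i.bodd (value d) := rfl
    rw [this, hv, ← Nat.div2_val, Nat.bit_bodd_div2]

theorem primrec_value : Primrec value := by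
  have h : Primrec fun q : Bool × ℕ => Nat.bit q.1 q.2 :=
    (Primrec.cond Primrec.fst (Primrec.nat_double_succ.comp Primrec.snd)
      (Primrec.nat_double.comp Primrec.snd)).of_eq fun ⟨b, r⟩ => by cases b <;> simp
  exact Primrec.list_foldr (h := fun (_ : List Bool) (q : Bool × ℕ) => Nat.bit q.1 q.2)
    Primrec.id (Primrec.const 0) (h.comp Primrec.snd).to₂

theorem primrec_bits : Primrec Nat.bits := by
  have h : Primrec₂ fun (_ : Unit) n => Nat.bits n := by
    refine Primrec.nat_strong_rec _ (g := fun _ l => bif l.length == 0 then some [] else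
      (l[l.length / 2]?).map (List.cons l.length.bodd)) ?_ fun _ n => ?_
    · have hl : Primrec fun p : Unit × List (List Bool) => p.2.length :=
        Primrec.list_length.comp Primrec.snd
      have hc : Primrec₂ fun (p : Unit × List (List Bool)) (l : List Bool) =>
          List.cons p.2.length.bodd l :=
        (Primrec.list_cons.comp (Primrec.nat_bodd.comp (hl.comp Primrec.fst)) Primrec.snd).to₂
      exact (Primrec.cond (Primrec.beq.comp hl (Primrec.const 0))
        (Primrec.const (some ([] : List Bool))) (Primrec.option_map (Primrec.list_getElem?.comp
          Primrec.snd (Primrec.nat_div.comp hl (Primrec.const 2))) hc)).to₂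
    · rcases Nat.eq_zero_or_pos n with rfl | hn
      · simp
      · have h2 : n / 2 < n := by omega
        have h3 : n.bits = n.bodd :: (n / 2).bits := by
          conv_lhs => rw [← Nat.bit_bodd_div2 n]
          rw [Nat.bits_append_bit, Nat.div2_val]
          intro h
          rw [Nat.div2_val] at h
          have : n = 1 := by omega
          subst this; rfl
        have h4 : (n == 0) = false := by simp; omega
        simp [h2, h3, h4]
  exact h.comp (Primrec.const ()) Primrec.id

/-- The product of the `k × n` matrix with row-major encoding `a` and the vector `y`. -/
def mulString (n k : ℕ) (a y : List Bool) : List Bool :=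
  (List.range k).map fun i => (List.range n).foldr
    (fun j b => xor (a.getD (i * n + j) false && y.getD j false) b) false

theorem primrec_mulString :
    Primrec fun p : (ℕ × ℕ) × List Bool × List Bool => mulString p.1.1 p.1.2 p.2.1 p.2.2 := by
  refine Primrec.list_map (Primrec.list_range.comp (Primrec.snd.comp Primrec.fst)) ?_
  refine (Primrec.list_foldr (Primrec.list_range.comp (Primrec.fst.comp
    (Primrec.fst.comp Primrec.fst))) (Primrec.const false)
    (h := fun (q : ((ℕ × ℕ) × List Bool × List Bool) × ℕ) (r : ℕ × Bool) =>
      xor (q.1.2.1.getD (q.2 * q.1.1.1 + r.1) false &&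
      q.1.2.2.getD r.1 false) r.2) ?_).to₂
  refine (Primrec.dom_bool₂ xor).comp (Primrec.and.comp ?_ ?_) (Primrec.snd.comp Primrec.snd)
  · refine (Primrec.list_getD false).comp (Primrec.fst.comp (Primrec.snd.comp
      (Primrec.fst.comp Primrec.fst))) (Primrec.nat_add.comp (Primrec.nat_mul.comp
        (Primrec.snd.comp Primrec.fst) (Primrec.fst.comp (Primrec.fst.comp
          (Primrec.fst.comp Primrec.fst)))) (Primrec.fst.comp Primrec.snd))
  · exact (Primrec.list_getD false).comp (Primrec.snd.comp (Primrec.snd.comp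
      (Primrec.fst.comp Primrec.fst))) (Primrec.fst.comp Primrec.snd)

/-- The least divisor of `N` whose square exceeds `N`. -/
def largeDivisor (N : ℕ) : ℕ :=
  (List.range (N + 1)).findIdx fun d => N % d == 0 && decide (N < d * d)

theorem primrec_largeDivisor : Primrec largeDivisor := by
  refine Primrec.list_findIdx (Primrec.list_range.comp Primrec.succ) ?_
  exact (Primrec.and.comp
    (Primrec.beq.comp (Primrec.nat_mod.comp Primrec.fst Primrec.snd) (Primrec.const 0))
    (Primrec.nat_lt.comp Primrec.fst
      (Primrec.nat_mul.comp Primrec.snd Primrec.snd)).decide).to₂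

theorem largeDivisor_mul {p k : ℕ} (hp : p.Prime) (hk : 0 < k) (hkp : k < p) :
    largeDivisor (p * k) = p := by
  have hlen : p < (List.range (p * k + 1)).length := by
    simp only [List.length_range]; nlinarith
  rw [largeDivisor, List.findIdx_eq hlen]
  constructor
  · simp only [List.getElem_range, Nat.mul_mod_right, beq_self_eq_true, Bool.true_and,
      decide_eq_true_eq]
    exact Nat.mul_lt_mul_of_pos_left hkp hp.pos
  · intro d hd
    simp only [List.getElem_range, Bool.and_eq_false_iff, beq_eq_false_iff_ne,
      decide_eq_false_iff_not, not_lt]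
    by_contra! h
    obtain ⟨h1, h2⟩ := h
    have hdvd : d ∣ p * k := Nat.dvd_of_mod_eq_zero h1
    have hd0 : 0 < d := Nat.pos_of_ne_zero (by rintro rfl; simp at h2)
    have hc : Nat.Coprime d p :=
      ((Nat.Prime.coprime_iff_not_dvd hp).2 (Nat.not_dvd_of_pos_of_lt hd0 hd)).symm
    have : d ≤ k := Nat.le_of_dvd hk (hc.dvd_of_dvd_mul_left hdvd)
    nlinarith

/-! ### Enumeration of a semidecidable family -/

section Enumeration

variable {α β : Type*} [DecidableEq β] [Primcodable β]

/-- The elements `b` with a witness `t` to `R a b t` found within the first `s` candidates,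
without repetition, in order of discovery. -/
def enumUpTo (R : α → β → ℕ → Bool) (a : α) : ℕ → List β
  | 0 => []
  | s + 1 => Option.casesOn (Encodable.decode (α := β × ℕ) s) (enumUpTo R a s) fun p =>
      if R a p.1 p.2 = true ∧ p.1 ∉ enumUpTo R a s then enumUpTo R a s ++ [p.1]
      else enumUpTo R a s

/-- The `i`-th element, in order of discovery, of `{b | ∃ t, R a b t}`. -/
def enumerated (R : α → β → ℕ → Bool) (p : α × ℕ) : Part β :=
  Nat.rfindOpt fun s => (enumUpTo R p.1 s)[p.2]?

theorem enumUpTo_succ (R : α → β → ℕ → Bool) (a : α) (s : ℕ) :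
    enumUpTo R a (s + 1) = enumUpTo R a s ∨ ∃ b t, Encodable.decode s = some (b, t) ∧
      R a b t = true ∧ b ∉ enumUpTo R a s ∧ enumUpTo R a (s + 1) = enumUpTo R a s ++ [b] := by
  rw [enumUpTo]
  rcases h : Encodable.decode (α := β × ℕ) s with _ | ⟨b, t⟩
  · exact Or.inl rfl
  · by_cases hb : R a b t = true ∧ b ∉ enumUpTo R a s
    · exact Or.inr ⟨b, t, rfl, hb.1, hb.2, by simp [hb]⟩
    · exact Or.inl (by simp only [if_neg hb])

theorem nodup_enumUpTo (R : α → β → ℕ → Bool) (a : α) (s : ℕ) : (enumUpTo R a s).Nodup := by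
  induction s with
  | zero => simp [enumUpTo]
  | succ s ih =>
    rcases enumUpTo_succ R a s with h | ⟨b, t, -, -, hb, h⟩
    · rwa [h]
    · rw [h, ← List.concat_eq_append]; exact ih.concat hb

theorem exists_of_mem_enumUpTo {R : α → β → ℕ → Bool} {a : α} {s : ℕ} {b : β}
    (hb : b ∈ enumUpTo R a s) : ∃ t, R a b t = true := by
  induction s with
  | zero => simp [enumUpTo] at hb
  | succ s ih =>
    rcases enumUpTo_succ R a s with h | ⟨b', t, -, hR, -, h⟩
    · exact ih (h ▸ hb)
    · rw [h, List.mem_append, List.mem_singleton] at hb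
      rcases hb with hb | rfl
      exacts [ih hb, ⟨t, hR⟩]

theorem mem_enumUpTo {R : α → β → ℕ → Bool} {a : α} {b : β} {t : ℕ} (h : R a b t = true) :
    b ∈ enumUpTo R a (Encodable.encode (b, t) + 1) := by
  rw [enumUpTo, Encodable.encodek]
  by_cases hb : b ∈ enumUpTo R a (Encodable.encode (b, t))
  · simp only [h, hb, not_true_eq_false, and_false, if_false]
  · simp only [h, hb, not_false_eq_true, and_true, if_true, List.mem_append, List.mem_singleton,
      or_true]

theorem enumUpTo_prefix_of_le (R : α → β → ℕ → Bool) (a : α) {s s' : ℕ} (h : s ≤ s') :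
    enumUpTo R a s <+: enumUpTo R a s' := by
  induction h with
  | refl => exact List.prefix_refl _
  | step _ ih =>
    refine ih.trans ?_
    rcases enumUpTo_succ R a _ with h | ⟨b, t, -, -, -, h⟩
    · rw [h]
    · rw [h]; exact List.prefix_append _ _

theorem exists_lt_mem_enumerated {R : α → β → ℕ → Bool} {a : α} {b : β} {t : ℕ}
    (h : R a b t = true) (S : Finset β) (hS : ∀ b t, R a b t = true → b ∈ S) :
    ∃ i < S.card, b ∈ enumerated R (a, i) := by
  obtain ⟨i, hi, hb⟩ := List.mem_iff_getElem.1 (mem_enumUpTo h)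
  refine ⟨i, hi.trans_le ?_, ?_⟩
  · rw [← List.toFinset_card_of_nodup (nodup_enumUpTo R a _)]
    refine Finset.card_le_card fun b hb => ?_
    obtain ⟨t, ht⟩ := exists_of_mem_enumUpTo (List.mem_toFinset.1 hb)
    exact hS b t ht
  · refine (Nat.rfindOpt_mono fun hmn ha => ?_).2 ⟨_, List.getElem?_eq_some_iff.2 ⟨hi, hb⟩⟩
    obtain ⟨r, hr⟩ := enumUpTo_prefix_of_le R a hmn
    obtain ⟨hlt, -⟩ := List.getElem?_eq_some_iff.1 ha
    rw [← hr, List.getElem?_append_left hlt]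
    exact ha

theorem partrec_enumerated [Primcodable α] {R : α → β → ℕ → Bool}
    (hR : Primrec fun p : α × β × ℕ => R p.1 p.2.1 p.2.2) : Partrec (enumerated R) := by
  have hmem : PrimrecPred fun q : β × List β => q.1 ∈ q.2 :=
    (PrimrecRel.exists_mem_list (R := fun x y : β => x = y) Primrec.eq).comp
      Primrec.snd Primrec.fst |>.of_eq fun q => by simp
  have h : Primrec fun p : α × ℕ => enumUpTo R p.1 p.2 := by
    refine (Primrec.nat_rec' (f := fun p : α × ℕ => p.2) (g := fun _ => ([] : List β))
      (h := fun p q => Option.casesOn (Encodable.decode (α := β × ℕ) q.1) q.2 fun r =>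
        if R p.1 r.1 r.2 = true ∧ r.1 ∉ q.2 then q.2 ++ [r.1] else q.2)
      Primrec.snd (Primrec.const []) ?_).of_eq fun p => ?_
    · have hL : Primrec fun z : ((α × ℕ) × ℕ × List β) × β × ℕ => z.1.2.2 :=
        Primrec.snd.comp (Primrec.snd.comp Primrec.fst)
      have hb : Primrec fun z : ((α × ℕ) × ℕ × List β) × β × ℕ => z.2.1 :=
        Primrec.fst.comp Primrec.snd
      have hif : Primrec fun z : ((α × ℕ) × ℕ × List β) × β × ℕ =>
          if R z.1.1.1 z.2.1 z.2.2 = true ∧ z.2.1 ∉ z.1.2.2 then z.1.2.2 ++ [z.2.1]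
          else z.1.2.2 :=
        Primrec.ite (PrimrecPred.and (Primrec.eq.comp (hR.comp ((Primrec.fst.comp
          (Primrec.fst.comp Primrec.fst)).pair Primrec.snd)) (Primrec.const true))
            (hmem.comp (hb.pair hL)).not) (Primrec.list_concat.comp hL hb) hL
      exact (Primrec.option_casesOn (Primrec.decode.comp (Primrec.fst.comp Primrec.snd))
        (Primrec.snd.comp Primrec.snd) hif.to₂).to₂
    · obtain ⟨a, s⟩ := p
      induction s with
      | zero => rfl
      | succ s ih => simp only at ih ⊢; rw [enumUpTo, ← ih]
  exact Partrec.rfindOpt (Primrec.list_getElem?.comp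
    (h.comp ((Primrec.fst.comp Primrec.fst).pair Primrec.snd))
    (Primrec.snd.comp Primrec.fst)).to_comp.to₂

end Enumeration

/-- Whether `a` encodes a `k × n` matrix such that within `t` steps the program `c` outputs
`a ++ a·y` on some string of length less than `n * k + k - 20`. -/
def compresses (c : Code) (p : ℕ × ℕ) (y : List Bool) (t : ℕ) (a : List Bool) : Prop :=
  a.length = p.1 * p.2 ∧ ∃ e ∈ stringsLt (p.1 * p.2 + p.2 - 20),
    Code.evaln t c (Encodable.encode e) = some (Encodable.encode (a ++ mulString p.1 p.2 a y))

instance (c : Code) (p : ℕ × ℕ) (y : List Bool) (t : ℕ) (a : List Bool) :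
    Decidable (compresses c p y t a) := inferInstanceAs (Decidable (_ ∧ _))

/-- Whether `y` is a nonzero string of length `n` for which at least `1/16` of the `k × n` matrices
satisfy `compresses`. -/
def compressesMany (c : Code) (p : ℕ × ℕ) (y : List Bool) (t : ℕ) : Bool :=
  decide ((y.length = p.1 ∧ true ∈ y) ∧ (stringsLt (p.1 * p.2)).length + 1 ≤
    16 * ((stringsLt (p.1 * p.2 + 1)).filter (compresses c p y t)).length)

theorem primrec_compressesMany (c : Code) :
    Primrec fun q : (ℕ × ℕ) × List Bool × ℕ => compressesMany c q.1 q.2.1 q.2.2 := by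
  have hmul : Primrec fun q : (ℕ × ℕ) × List Bool × ℕ => q.1.1 * q.1.2 :=
    Primrec.nat_mul.comp (Primrec.fst.comp Primrec.fst) (Primrec.snd.comp Primrec.fst)
  have hy : Primrec fun q : (ℕ × ℕ) × List Bool × ℕ => q.2.1 := Primrec.fst.comp Primrec.snd
  have hmem : PrimrecPred fun y : List Bool => true ∈ y :=
    (PrimrecPred.exists_mem_list (Primrec.eq.comp Primrec.id (Primrec.const true))).of_eq
      fun q => by simp
  have hrel : PrimrecRel fun (e : List Bool) (r : List Bool × (ℕ × ℕ) × List Bool × ℕ) =>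
      Code.evaln r.2.2.2 c (Encodable.encode e) =
        some (Encodable.encode (r.1 ++ mulString r.2.1.1 r.2.1.2 r.1 r.2.2.1)) := by
    have hm : Primrec fun z : List Bool × List Bool × (ℕ × ℕ) × List Bool × ℕ =>
        z.2.1 ++ mulString z.2.2.1.1 z.2.2.1.2 z.2.1 z.2.2.2.1 :=
      (Primrec.list_append.comp Primrec.fst (primrec_mulString.comp ((Primrec.fst.comp
        Primrec.snd).pair (Primrec.fst.pair (hy.comp Primrec.snd))))).comp Primrec.snd
    have he : Primrec fun z : List Bool × List Bool × (ℕ × ℕ) × List Bool × ℕ =>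
        Code.evaln z.2.2.2.2 c (Encodable.encode z.1) :=
      Code.primrec_evaln.comp (((Primrec.snd.comp (Primrec.snd.comp (Primrec.snd.comp
        Primrec.snd))).pair (Primrec.const c)).pair (Primrec.encode.comp Primrec.fst))
    exact PrimrecPred.primrecRel (Primrec.eq.comp he
      (Primrec.option_some.comp (Primrec.encode.comp hm)))
  have hfil : PrimrecRel fun (a : List Bool) (q : (ℕ × ℕ) × List Bool × ℕ) =>
      compresses c q.1 q.2.1 q.2.2 a := by
    have hN : Primrec fun z : List Bool × (ℕ × ℕ) × List Bool × ℕ =>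
        stringsLt (z.2.1.1 * z.2.1.2 + z.2.1.2 - 20) :=
      primrec_stringsLt.comp (Primrec.nat_sub.comp (Primrec.nat_add.comp (hmul.comp Primrec.snd)
        (Primrec.snd.comp (Primrec.fst.comp Primrec.snd))) (Primrec.const 20))
    exact PrimrecPred.primrecRel (PrimrecPred.and (Primrec.eq.comp
      (Primrec.list_length.comp Primrec.fst) (hmul.comp Primrec.snd))
        (hrel.exists_mem_list.comp hN Primrec.id))
  refine PrimrecPred.decide (PrimrecPred.and (PrimrecPred.and (Primrec.eq.comp
    (Primrec.list_length.comp hy) (Primrec.fst.comp Primrec.fst)) (hmem.comp hy)) ?_)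
  refine Primrec.nat_le.comp (Primrec.succ.comp (Primrec.list_length.comp
    (primrec_stringsLt.comp hmul))) (Primrec.nat_mul.comp (Primrec.const 16)
      (Primrec.list_length.comp ?_))
  exact hfil.listFilter.comp (primrec_stringsLt.comp (Primrec.succ.comp hmul)) Primrec.id

/-- The standard universal decompressor: after a unary index of a program comes its input. -/
def universal (p : List Bool × List Bool) : Part (List Bool) :=
  ((Denumerable.ofNat Code (p.1.takeWhile id).length).eval
    (Encodable.encode ((p.1.dropWhile id).tail, p.2))).bind
      fun m => ((Encodable.decode m : Option (List Bool)) : Part (List Bool))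

theorem partrec_universal : Partrec universal := by
  refine Partrec.bind (Code.eval_part.comp ?_ ?_)
    (Computable.ofOption (Computable.decode.comp Computable.snd)).to₂
  · exact (Primrec.list_length.comp ((Primrec.list_takeWhile Primrec.id).comp
      Primrec.fst)).to_comp.comp Computable.id |> (Computable.ofNat Code).comp
  · exact (Primrec.encode.comp ((Primrec.list_tail.comp ((Primrec.list_dropWhile
      Primrec.id).comp Primrec.fst)).pair Primrec.snd)).to_comp

theorem exists_universal {W : List Bool × List Bool →. List Bool} (hW : Partrec W) :
    ∃ c : ℕ, ∀ d y x, x ∈ W (d, y) → ∃ d', d'.length = d.length + c ∧ x ∈ universal (d', y) := by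
  obtain ⟨c, hc⟩ := Code.exists_code.1 hW
  refine ⟨Encodable.encode c + 1, fun d y x hx =>
    ⟨List.replicate (Encodable.encode c) true ++ false :: d, by simp; omega, ?_⟩⟩
  have h1 : (List.replicate (Encodable.encode c) true ++ false :: d).takeWhile id =
      List.replicate (Encodable.encode c) true := by
    rw [List.takeWhile_append_of_pos (by simp)]; simp
  have h2 : (List.replicate (Encodable.encode c) true ++ false :: d).dropWhile id = false :: d := by
    rw [List.dropWhile_append_of_pos (by simp)]; simp
  simp only [universal, h1, h2, List.length_replicate, Denumerable.ofNat_encode, hc]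
  simpa using hx

/-- A program computing the plain decompressor `universal (·, [])`. -/
theorem exists_code_universal : ∃ c : Code, ∀ e z : List Bool, z ∈ universal (e, []) ↔
    ∃ t, Code.evaln t c (Encodable.encode e) = some (Encodable.encode z) := by
  obtain ⟨c, hc⟩ := Code.exists_code.1 (partrec_universal.comp
    (Computable.id.pair (Computable.const ([] : List Bool))) :
      Partrec fun e : List Bool => universal (e, []))
  refine ⟨c, fun e z => ?_⟩
  have h : Encodable.encode z ∈ c.eval (Encodable.encode e) ↔ z ∈ universal (e, []) := by
    rw [hc]; simp
  rw [← h, Code.evaln_complete]; rfl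

end Computability

/-! ### Matrices and strings -/

section Matrices

open Finset

theorem zmod_two_eq_of_eq_one_iff {a b : ZMod 2} (h : a = 1 ↔ b = 1) : a = b := by
  revert a b; decide

theorem encM_eq_ofFn {k n : ℕ} (A : Matrix (Fin k) (Fin n) (ZMod 2)) :
    encM A = List.ofFn fun m : Fin (k * n) => decide (A m.divNat m.modNat = 1) := by
  rw [List.ofFn_mul, encM, List.flatMap_def, ← List.ofFn_eq_map]
  congr 2
  funext i
  rw [← List.ofFn_eq_map]
  congr 1
  funext j
  have h := finProdFinEquiv.symm_apply_apply (i, j)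
  have hm : finProdFinEquiv (i, j) = ⟨i * n + j, by
      have := (finProdFinEquiv (i, j)).2; simp only [finProdFinEquiv_apply_val] at this; lia⟩ := by
    ext; simp [finProdFinEquiv_apply_val]; ring
  rw [hm, finProdFinEquiv_symm_apply, Prod.mk.injEq] at h
  rw [h.1, h.2]

theorem length_encM {k n : ℕ} (A : Matrix (Fin k) (Fin n) (ZMod 2)) :
    (encM A).length = n * k := by
  rw [encM_eq_ofFn, List.length_ofFn, mul_comm]

theorem getD_encM {k n : ℕ} (A : Matrix (Fin k) (Fin n) (ZMod 2)) (i : Fin k) (j : Fin n) :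
    (encM A).getD (i * n + j) false = decide (A i j = 1) := by
  have h := finProdFinEquiv.symm_apply_apply (i, j)
  have hv : (finProdFinEquiv (i, j) : ℕ) = i * n + j := by
    simp [finProdFinEquiv_apply_val]; ring
  rw [finProdFinEquiv_symm_apply, Prod.mk.injEq] at h
  rw [encM_eq_ofFn, ← hv, List.getD_eq_getElem _ _
    (by rw [List.length_ofFn]; exact (finProdFinEquiv (i, j)).2), List.getElem_ofFn]
  simp only [Fin.eta, h.1, h.2]

theorem encM_injective {k n : ℕ} :
    Function.Injective (encM : Matrix (Fin k) (Fin n) (ZMod 2) → List Bool) := by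
  intro A B h
  ext i j
  have := getD_encM A i j
  rw [h, getD_encM, decide_eq_decide] at this
  exact (zmod_two_eq_of_eq_one_iff this).symm

theorem encM_surjective {k n : ℕ} {a : List Bool} (ha : a.length = n * k) :
    ∃ A : Matrix (Fin k) (Fin n) (ZMod 2), encM A = a := by
  refine ⟨Matrix.of fun i j => if a.getD (i * n + j) false then 1 else 0, ?_⟩
  rw [encM_eq_ofFn]
  refine List.ext_getElem (by rw [List.length_ofFn, ha, mul_comm]) fun m h1 h2 => ?_
  have : m / n * n + m % n = m := by rw [mul_comm, Nat.div_add_mod]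
  simp [this, h2]

theorem strOf_injective {k : ℕ} : Function.Injective (strOf : (Fin k → ZMod 2) → List Bool) := by
  intro v w h
  funext i
  have := congrFun (List.ofFn_injective h) i
  exact zmod_two_eq_of_eq_one_iff (decide_eq_decide.1 this)

theorem length_strOf {k : ℕ} (v : Fin k → ZMod 2) : (strOf v).length = k := by simp [strOf]

theorem strOf_vecOf {n : ℕ} {y : List Bool} (h : y.length = n) : strOf (vecOf n y) = y := by
  refine List.ext_getElem (by simp [length_strOf, h]) fun i h1 h2 => ?_
  simp [strOf, vecOf, h2]

theorem vecOf_ne_zero {n : ℕ} {y : List Bool} (h : y.length = n) (hy : true ∈ y) :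
    vecOf n y ≠ 0 := by
  intro h0
  rw [← strOf_vecOf h, h0] at hy
  simp [strOf] at hy

theorem foldr_xor_eq (l : List ℕ) (g : ℕ → Bool) :
    l.foldr (fun j b => xor (g j) b) false =
      decide ((l.map fun j => if g j then (1 : ZMod 2) else 0).sum = 1) := by
  induction l with
  | nil => simp
  | cons j l ih =>
    rw [List.foldr_cons, ih, List.map_cons, List.sum_cons]
    generalize (l.map fun j => if g j then (1 : ZMod 2) else 0).sum = s
    revert s
    cases g j <;> decide

theorem mulString_encM {k n : ℕ} (A : Matrix (Fin k) (Fin n) (ZMod 2)) (y : List Bool) :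
    mulString n k (encM A) y = strOf (A.mulVec (vecOf n y)) := by
  refine List.ext_getElem (by simp [mulString, length_strOf]) fun i h1 h2 => ?_
  rw [length_strOf] at h2
  simp only [mulString, List.getElem_map, List.getElem_range, strOf, List.getElem_ofFn,
    foldr_xor_eq]
  rw [show (List.range n).map (fun j => if ((encM A).getD (i * n + j) false && y.getD j false) then
    (1 : ZMod 2) else 0) = List.ofFn (fun j : Fin n => A ⟨i, h2⟩ j * vecOf n y j) from ?_,
    List.sum_ofFn]
  · rfl
  · refine List.ext_getElem (by simp) fun j hj hj' => ?_
    rw [List.length_ofFn] at hj'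
    have := getD_encM A ⟨i, h2⟩ ⟨j, hj'⟩
    simp only [List.getElem_map, List.getElem_range, List.getElem_ofFn, this, vecOf]
    generalize A ⟨i, h2⟩ ⟨j, hj'⟩ = a
    generalize y.getD j false = b
    revert a b
    decide

variable {n k : ℕ}

theorem card_matrix : Fintype.card (Matrix (Fin k) (Fin n) (ZMod 2)) = 2 ^ (n * k) := by
  rw [← Nat.card_eq_fintype_card, Matrix]
  simp [← pow_mul]

theorem card_mulVec_eq {v : Fin n → ZMod 2} (hv : v ≠ 0) (f : Fin k → ZMod 2) :
    #{A : Matrix (Fin k) (Fin n) (ZMod 2) | A.mulVec v = f} * 2 ^ k = 2 ^ (n * k) := by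
  obtain ⟨j, hj⟩ := Function.ne_iff.1 hv
  have hj1 : v j = 1 := by
    have : ∀ a : ZMod 2, a ≠ 0 → a = 1 := by decide
    exact this _ hj
  let φ : Matrix (Fin k) (Fin n) (ZMod 2) →+ (Fin k → ZMod 2) :=
    { toFun := fun A => A.mulVec v
      map_zero' := Matrix.zero_mulVec v
      map_add' := fun A B => Matrix.add_mulVec A B v }
  have hsurj (g : Fin k → ZMod 2) : g ∈ Set.range φ := by
    refine ⟨Matrix.of fun i j' => if j' = j then g i else 0, ?_⟩
    funext i
    simp [φ, Matrix.mulVec, dotProduct, hj1]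
  have hfib (g : Fin k → ZMod 2) : #{A | φ A = g} = #{A | φ A = f} :=
    AddMonoidHom.card_fiber_eq_of_mem_range φ (hsurj g) (hsurj f)
  have htot := card_eq_sum_card_fiberwise (s := univ) (t := univ) (f := φ) (by simp)
  rw [sum_congr rfl fun g _ => hfib g, sum_const, card_univ, card_univ, card_matrix] at htot
  rw [htot]
  simp [mul_comm, φ]

theorem card_mulVec_eq_mulVec {v w : Fin n → ZMod 2} (h : v ≠ w) :
    #{A : Matrix (Fin k) (Fin n) (ZMod 2) | A.mulVec v = A.mulVec w} * 2 ^ k = 2 ^ (n * k) := by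
  rw [← card_mulVec_eq (sub_ne_zero.2 h) 0]
  simp [Matrix.mulVec_sub, sub_eq_zero]

/-- Multiplication by a random matrix is a pairwise independent hash: few nonzero vectors are
mapped by many matrices into a small set. -/
theorem card_frequently_mapped_le (T : Finset (Matrix (Fin k) (Fin n) (ZMod 2) × (Fin k → ZMod 2)))
    (Y : Finset (Fin n → ZMod 2)) (hT : #T * 2 ^ 20 ≤ 2 ^ (n * k) * 2 ^ k)
    (hY : ∀ v ∈ Y, 2 ^ (n * k) ≤ 16 * #{A : Matrix (Fin k) (Fin n) (ZMod 2) |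
      (A, A.mulVec v) ∈ T}) :
    #Y * 2 ^ 11 ≤ 2 ^ k := by
  set M := 2 ^ (n * k) with hM
  set K := 2 ^ k with hK
  have hM0 : 0 < M := by positivity
  let hits (p : Matrix (Fin k) (Fin n) (ZMod 2) × (Fin k → ZMod 2)) : ℕ :=
    #{v ∈ Y | p.1.mulVec v = p.2}
  have hX : #Y * M ≤ 16 * ∑ p ∈ T, hits p := by
    have h1 (v : Fin n → ZMod 2) : #{A : Matrix (Fin k) (Fin n) (ZMod 2) |
        (A, A.mulVec v) ∈ T} ≤ #{p ∈ T | p.1.mulVec v = p.2} := by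
      refine card_le_card_of_injOn (fun A => (A, A.mulVec v)) (fun A hA => ?_) fun A _ B _ h => ?_
      · simpa using hA
      · exact congrArg Prod.fst h
    have h2 : ∑ p ∈ T, hits p = ∑ v ∈ Y, #{p ∈ T | p.1.mulVec v = p.2} :=
      sum_card_bipartiteAbove_eq_sum_card_bipartiteBelow
        (fun (p : Matrix (Fin k) (Fin n) (ZMod 2) × (Fin k → ZMod 2)) v => p.1.mulVec v = p.2)
    rw [h2, mul_sum, ← smul_eq_mul, ← sum_const]
    exact sum_le_sum fun v hv => (hY v hv).trans (Nat.mul_le_mul_left _ (h1 v))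
  have hCS : (∑ p ∈ T, hits p) ^ 2 ≤ #T * ∑ p, hits p ^ 2 :=
    sq_sum_le_card_mul_sum_sq.trans
      (Nat.mul_le_mul_left _ (sum_le_univ_sum_of_nonneg fun _ => Nat.zero_le _))
  have hQ : (∑ p, hits p ^ 2) * K ≤ #Y * M * K + #Y * #Y * M := by
    have h1 : ∑ p, hits p ^ 2 = ∑ v ∈ Y, ∑ w ∈ Y,
        #{A : Matrix (Fin k) (Fin n) (ZMod 2) | A.mulVec v = A.mulVec w} := by
      simp only [hits, card_filter, sq, sum_mul_sum, Fintype.sum_prod_type]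
      simp only [sum_comm (s := univ) (t := Y)]
      simp [eq_comm]
    rw [h1, sum_mul]
    calc ∑ v ∈ Y, (∑ w ∈ Y, #{A : Matrix (Fin k) (Fin n) (ZMod 2) |
            A.mulVec v = A.mulVec w}) * K
        ≤ ∑ v ∈ Y, (M * K + #Y * M) := by
          refine sum_le_sum fun v hv => ?_
          rw [sum_mul, ← add_sum_erase _ _ hv]
          refine add_le_add ?_ ?_
          · simp [card_matrix, hM]
          · refine (sum_le_card_nsmul _ _ M fun w hw => ?_).trans ?_
            · exact (card_mulVec_eq_mulVec (ne_of_mem_erase hw).symm).le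
            · exact Nat.mul_le_mul_right _ (card_le_card (erase_subset _ _))
      _ = #Y * M * K + #Y * #Y * M := by rw [sum_const, smul_eq_mul]; ring
  rcases Nat.eq_zero_or_pos #Y with h0 | h0
  · simp [h0]
  generalize ∑ p ∈ T, hits p = X at hX hCS
  generalize ∑ p, hits p ^ 2 = Q at hCS hQ
  have h1 : (#Y * M) ^ 2 ≤ 256 * (#T * Q) := by
    calc (#Y * M) ^ 2 ≤ (16 * X) ^ 2 := Nat.pow_le_pow_left hX 2
      _ = 256 * X ^ 2 := by ring
      _ ≤ _ := Nat.mul_le_mul_left _ hCS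
  have h2 : 2 ^ 20 * (#Y * M) ^ 2 ≤ 256 * (M * (Q * K)) := by
    calc 2 ^ 20 * (#Y * M) ^ 2 ≤ 2 ^ 20 * (256 * (#T * Q)) := Nat.mul_le_mul_left _ h1
      _ = 256 * Q * (#T * 2 ^ 20) := by ring
      _ ≤ 256 * Q * (M * K) := Nat.mul_le_mul_left _ hT
      _ = _ := by ring
  have h3 : (#Y * M * M) * (2 ^ 20 * #Y) ≤ (#Y * M * M) * (256 * (K + #Y)) := by
    calc (#Y * M * M) * (2 ^ 20 * #Y) = 2 ^ 20 * (#Y * M) ^ 2 := by ring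
      _ ≤ 256 * (M * (Q * K)) := h2
      _ ≤ 256 * (M * (#Y * M * K + #Y * #Y * M)) := by gcongr
      _ = _ := by ring
  have h4 := Nat.le_of_mul_le_mul_left h3 (by positivity)
  clear_value K
  generalize #Y = m at h4 ⊢
  clear * - h4
  lia

end Matrices

/-! ### Complexity -/

section Complexity

theorem condC_le_length {V : List Bool × List Bool →. List Bool} {d y x : List Bool}
    (h : x ∈ V (d, y)) : condC V x y ≤ d.length :=
  sInf_le ⟨d, h, rfl⟩

theorem exists_mem_of_condC_ne_top {V : List Bool × List Bool →. List Bool} {y x : List Bool}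
    (h : condC V x y ≠ ⊤) : ∃ d, x ∈ V (d, y) ∧ (d.length : ℕ∞) = condC V x y := by
  refine csInf_mem (s := {m : ℕ∞ | ∃ d : List Bool, x ∈ V (d, y) ∧ (d.length : ℕ∞) = m}) ?_
  by_contra hne
  rw [Set.not_nonempty_iff_eq_empty] at hne
  exact h (by rw [condC, hne, sInf_empty])

theorem condC_le_add {V W : List Bool × List Bool →. List Bool} {c : ℕ} {x y : List Bool}
    (h : ∀ d, x ∈ W (d, y) → ∃ d', d'.length = d.length + c ∧ x ∈ V (d', y)) :
    condC V x y ≤ condC W x y + c := by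
  by_cases htop : condC W x y = ⊤
  · simp [htop]
  · obtain ⟨d, hd, hl⟩ := exists_mem_of_condC_ne_top htop
    obtain ⟨d', hd', hx⟩ := h d hd
    rw [← hl]
    exact_mod_cast hd' ▸ condC_le_length hx

theorem condUniversal_of_universal {V : List Bool × List Bool →. List Bool} (hV : Partrec V)
    {c : ℕ} (h : ∀ d y x, x ∈ universal (d, y) →
      ∃ d', d'.length = d.length + c ∧ x ∈ V (d', y)) : CondUniversal V := by
  refine ⟨hV, fun W hW => ?_⟩
  obtain ⟨b, hb⟩ := exists_universal hW
  refine ⟨b + c, fun x y => condC_le_add fun d hd => ?_⟩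
  obtain ⟨e, he, hx⟩ := hb d y x hd
  obtain ⟨d', hd', hx'⟩ := h e y x hx
  exact ⟨d', by omega, hx'⟩

theorem plainUniversal_of_universal {U : List Bool →. List Bool} (hU : Partrec U) {c : ℕ}
    (h : ∀ d x, x ∈ universal (d, []) → ∃ d', d'.length = d.length + c ∧ x ∈ U d') :
    PlainUniversal U := by
  refine ⟨hU, fun W hW => ?_⟩
  obtain ⟨b, hb⟩ := exists_universal (W := fun p => W p.1) (hW.comp Computable.fst)
  refine ⟨b + c, fun x => condC_le_add (V := fun p => U p.1) (W := fun p => W p.1) (y := [])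
    fun d hd => ?_⟩
  obtain ⟨e, he, hx⟩ := hb d [] x hd
  obtain ⟨d', hd', hx'⟩ := h e x hx
  exact ⟨d', by omega, hx'⟩

theorem plainC_lt_of_mem {U : List Bool →. List Bool} {u x : List Bool} {N : ℕ} (h : x ∈ U u)
    (hu : u.length < N) : plainC U x < N :=
  lt_of_le_of_lt (sInf_le ⟨u, h, rfl⟩) (by exact_mod_cast hu)

theorem le_plainC {U : List Bool →. List Bool} {x : List Bool} {N : ℕ}
    (h : ∀ u, x ∈ U u → N ≤ u.length) : (N : ℕ∞) ≤ plainC U x := by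
  refine le_sInf ?_
  rintro _ ⟨u, hu, rfl⟩
  exact_mod_cast h u hu

end Complexity

/-! ### The two decompressors -/

section Machines

/-- The conditional decompressor. Given `n` as condition, the empty string describes `0ⁿ`, a
leading `true` calls the universal machine, and a string `false :: d` describes an element of the
enumeration of the vectors `y` that have many compressible pairs `(A, A y)`, where `A` has
`d.length + 11` rows. -/
def condMachine (c : Code) (p : List Bool × List Bool) : Part (List Bool) :=
  bif p.1.isEmpty then Part.some (List.replicate (value p.2) false)
  else bif p.1.headI then universal (p.1.tail, p.2)
  else enumerated (compressesMany c) ((value p.2, p.1.tail.length + 11), value p.1.tail)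

theorem primrec_replicate_false : Primrec fun m : ℕ => List.replicate m false :=
  (Primrec.list_map Primrec.list_range (Primrec.const false).to₂).of_eq fun m => by simp

theorem partrec_condMachine (c : Code) : Partrec (condMachine c) := by
  have hv : Primrec fun p : List Bool × List Bool => value p.2 := primrec_value.comp Primrec.snd
  have ht : Primrec fun p : List Bool × List Bool => p.1.tail :=
    Primrec.list_tail.comp Primrec.fst
  refine Partrec.cond ?_ ?_ (Partrec.cond ?_ ?_ ?_)
  · exact ((Primrec.beq (α := ℕ)).comp (Primrec.list_length.comp Primrec.fst)
      (Primrec.const 0)).to_comp.of_eq fun p => by rcases p with ⟨_ | _, _⟩ <;> rfl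
  · exact (primrec_replicate_false.comp hv).to_comp.partrec
  · exact (Primrec.list_headI.comp Primrec.fst).to_comp
  · exact partrec_universal.comp (ht.pair Primrec.snd).to_comp
  · exact (partrec_enumerated (primrec_compressesMany c)).comp ((hv.pair (Primrec.nat_add.comp
      (Primrec.list_length.comp ht) (Primrec.const 11))).pair (primrec_value.comp ht)).to_comp

theorem condUniversal_condMachine (c : Code) : CondUniversal (condMachine c) :=
  condUniversal_of_universal (partrec_condMachine c) (c := 1) fun d _ _ hx =>
    ⟨true :: d, rfl, hx⟩

/-- The dimensions `(n, k)` of a matrix recovered from a string of length `n * k + k - 5`. -/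
def dimensions (w : List Bool) : ℕ × ℕ :=
  (largeDivisor (w.length + 5) - 1, (w.length + 5) / largeDivisor (w.length + 5))

theorem primrec_dimensions : Primrec dimensions := by
  have h : Primrec fun w : List Bool => w.length + 5 :=
    Primrec.nat_add.comp Primrec.list_length (Primrec.const 5)
  exact (Primrec.pred.comp (primrec_largeDivisor.comp h)).pair
    (Primrec.nat_div.comp h (primrec_largeDivisor.comp h))

theorem dimensions_eq {n k : ℕ} {w : List Bool} (hp : (n + 1).Prime) (hk : 5 ≤ k) (hkn : k < n)
    (hw : w.length + 5 = n * k + k) : dimensions w = (n, k) := by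
  have h : largeDivisor (w.length + 5) = n + 1 := by
    rw [hw, ← Nat.succ_mul]
    exact largeDivisor_mul hp (by omega) (by omega)
  rw [dimensions, h, hw, ← Nat.succ_mul]
  simp

/-- From `w = enc(A) · d`, where `d` describes `y` given `n`, compute `enc(A) · A y · 0⁹`. -/
def hashMachine (c : Code) (w : List Bool) : Part (List Bool) :=
  (condMachine c (w.drop ((dimensions w).1 * (dimensions w).2), (dimensions w).1.bits)).map fun y =>
    w.take ((dimensions w).1 * (dimensions w).2) ++
      mulString (dimensions w).1 (dimensions w).2
        (w.take ((dimensions w).1 * (dimensions w).2)) y ++ List.replicate 9 false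

theorem partrec_hashMachine (c : Code) : Partrec (hashMachine c) := by
  have hm : Primrec fun w : List Bool => (dimensions w).1 * (dimensions w).2 := Primrec.nat_mul.comp
    (Primrec.fst.comp primrec_dimensions) (Primrec.snd.comp primrec_dimensions)
  have ht : Primrec fun w : List Bool => w.take ((dimensions w).1 * (dimensions w).2) :=
    Primrec.list_take.comp hm Primrec.id
  have hout : Primrec fun z : List Bool × List Bool =>
      z.1.take ((dimensions z.1).1 * (dimensions z.1).2) ++
        mulString (dimensions z.1).1 (dimensions z.1).2
          (z.1.take ((dimensions z.1).1 * (dimensions z.1).2)) z.2 ++ List.replicate 9 false :=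
    Primrec.list_append.comp (Primrec.list_append.comp (ht.comp Primrec.fst)
      (primrec_mulString.comp ((primrec_dimensions.comp Primrec.fst).pair
        ((ht.comp Primrec.fst).pair Primrec.snd)))) (Primrec.const _)
  refine Partrec.map ((partrec_condMachine c).comp ?_) hout.to_comp.to₂
  exact ((Primrec.list_drop.comp hm Primrec.id).pair
    (primrec_bits.comp (Primrec.fst.comp primrec_dimensions))).to_comp

/-- The plain decompressor: a program starting with `true` loses its first 20 bits and is run on the
universal machine, any other program is run, without its first bit, on `hashMachine`. -/
def plainMachine (c : Code) (u : List Bool) : Part (List Bool) :=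
  bif u.headI then universal (u.drop 20, []) else hashMachine c u.tail

theorem partrec_plainMachine (c : Code) : Partrec (plainMachine c) := by
  refine Partrec.cond Primrec.list_headI.to_comp (partrec_universal.comp ?_)
    ((partrec_hashMachine c).comp Primrec.list_tail.to_comp)
  exact ((Primrec.list_drop.comp (Primrec.const 20) Primrec.id).pair (Primrec.const [])).to_comp

theorem plainUniversal_plainMachine (c : Code) : PlainUniversal (plainMachine c) :=
  plainUniversal_of_universal (partrec_plainMachine c) (c := 20) fun d _ hx =>
    ⟨List.replicate 20 true ++ d, by rw [List.length_append, List.length_replicate, add_comm], hx⟩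

theorem mem_plainMachine_of_mem_condMachine {c : Code} {n k : ℕ} {y d : List Bool}
    (hp : (n + 1).Prime) (hkn : k < n) (hd : y ∈ condMachine c (d, n.bits))
    (hk : k = d.length + 5) (A : Matrix (Fin k) (Fin n) (ZMod 2)) :
    encM A ++ strOf (A.mulVec (vecOf n y)) ++ List.replicate 9 false ∈
      plainMachine c (false :: (encM A ++ d)) := by
  have hdim : dimensions (encM A ++ d) = (n, k) :=
    dimensions_eq hp (by omega) hkn (by rw [List.length_append, length_encM]; omega)
  have hm : n * k = (encM A).length := (length_encM A).symm
  simp only [plainMachine, List.headI, List.tail, cond_false, hashMachine, hdim, hm,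
    List.drop_left, List.take_left, ← mulString_encM]
  exact Part.mem_map _ hd

theorem mem_plainMachine {c : Code} {u z : List Bool} (h : z ∈ plainMachine c u) :
    z ∈ universal (u.drop 20, []) ∨ ∃ a, z = a ++ List.replicate 9 false := by
  rcases hu : u.headI with _ | _
  · rw [plainMachine, hu, cond_false, hashMachine, Part.mem_map_iff] at h
    obtain ⟨y, -, rfl⟩ := h
    exact Or.inr ⟨_, rfl⟩
  · rw [plainMachine, hu, cond_true] at h
    exact Or.inl h

end Machines

/-! ### Counting -/

section Counting

open Finset

theorem card_le_of_suffix_eq_zero {α : Type*} {g : α → List Bool} (hg : Function.Injective g)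
    {N m : ℕ} (hlen : ∀ a, (g a).length = N) (S : Finset α)
    (hS : ∀ a ∈ S, ∀ i, m ≤ i → (g a).getD i false = false) : #S ≤ 2 ^ m := by
  have hcard : #(univ : Finset (Fin m → Bool)) = 2 ^ m := by simp
  rw [← hcard]
  refine card_le_card_of_injOn (fun a (i : Fin m) => (g a).getD i false) (by simp)
    fun a ha b hb hab => hg (List.ext_getElem (by rw [hlen, hlen]) fun i h1 h2 => ?_)
  have : (g a).getD i false = (g b).getD i false := by
    rcases lt_or_ge i m with him | him
    · exact congrFun hab ⟨i, him⟩
    · rw [hS a ha i him, hS b hb i him]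
  simpa [h1, h2] using this

theorem getD_append_replicate_false {a : List Bool} {r i : ℕ} (h : a.length ≤ i) :
    (a ++ List.replicate r false).getD i false = false := by
  rw [List.getD_append_right _ _ _ _ h]
  rcases lt_or_ge (i - a.length) r with h | h <;> simp [h, List.getD_eq_getElem?_getD]

variable {n k : ℕ}

open Classical in
/-- The pairs of a matrix and a vector whose joint encoding has a program of length less than
`m` for the universal machine. -/
noncomputable def compressible (n k m : ℕ) :
    Finset (Matrix (Fin k) (Fin n) (ZMod 2) × (Fin k → ZMod 2)) :=
  {p | ∃ e : List Bool, e.length < m ∧ encM p.1 ++ strOf p.2 ∈ universal (e, [])}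

theorem mem_compressible {m : ℕ} {A : Matrix (Fin k) (Fin n) (ZMod 2)} {f : Fin k → ZMod 2} :
    (A, f) ∈ compressible n k m ↔
      ∃ e : List Bool, e.length < m ∧ encM A ++ strOf f ∈ universal (e, []) := by
  simp [compressible]

theorem card_compressible_lt (n k m : ℕ) : #(compressible n k m) < 2 ^ m := by
  rw [← length_stringsLt, Nat.lt_succ_iff, ← List.toFinset_card_of_nodup (nodup_stringsLt m)]
  refine card_le_card_of_forall_subsingleton
    (fun p e => encM p.1 ++ strOf p.2 ∈ universal (e, [])) (fun p hp => ?_) ?_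
  · obtain ⟨e, he, h⟩ := mem_compressible.1 hp
    exact ⟨e, List.mem_toFinset.2 (mem_stringsLt.2 he), h⟩
  · rintro e - ⟨A, f⟩ ⟨-, h⟩ ⟨B, g⟩ ⟨-, h'⟩
    obtain ⟨h1, h2⟩ := List.append_inj (Part.mem_unique h h')
      (by rw [length_encM, length_encM])
    exact Prod.ext (encM_injective h1) (strOf_injective h2)

/-- The matrices `A` for which `enc(A) · A v` has a program of length less than `n * k + k - 20`. -/
noncomputable def compressibleMatrices (v : Fin n → ZMod 2) (k : ℕ) :
    Finset (Matrix (Fin k) (Fin n) (ZMod 2)) :=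
  {A | (A, A.mulVec v) ∈ compressible n k (n * k + k - 20)}

theorem mem_compressibleMatrices {v : Fin n → ZMod 2} {A : Matrix (Fin k) (Fin n) (ZMod 2)} :
    A ∈ compressibleMatrices v k ↔ ∃ e : List Bool, e.length < n * k + k - 20 ∧
      encM A ++ strOf (A.mulVec v) ∈ universal (e, []) := by
  simp [compressibleMatrices, mem_compressible]

theorem card_compressibleMatrices_lt (v : Fin n → ZMod 2) (k : ℕ) :
    #(compressibleMatrices v k) < 2 ^ (n * k + k - 20) :=
  (card_le_card_of_injOn (fun A => (A, A.mulVec v)) (fun A hA => by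
    simpa [compressibleMatrices] using hA) fun _ _ _ _ h => congrArg Prod.fst h).trans_lt
      (card_compressible_lt n k _)

variable {c : Code}

theorem mem_compressibleMatrices_iff_compresses
    (hc : ∀ e z : List Bool, z ∈ universal (e, []) ↔
      ∃ t, Code.evaln t c (Encodable.encode e) = some (Encodable.encode z))
    {y : List Bool}
    {A : Matrix (Fin k) (Fin n) (ZMod 2)} :
    A ∈ compressibleMatrices (vecOf n y) k ↔ ∃ t, compresses c (n, k) y t (encM A) := by
  simp only [mem_compressibleMatrices, compresses, mulString_encM, length_encM, true_and,
    mem_stringsLt, hc]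
  grind

theorem exists_compressesMany_iff
    (hc : ∀ e z : List Bool, z ∈ universal (e, []) ↔
      ∃ t, Code.evaln t c (Encodable.encode e) = some (Encodable.encode z))
    {y : List Bool} :
    (∃ t, compressesMany c (n, k) y t = true) ↔ (y.length = n ∧ true ∈ y) ∧
      2 ^ (n * k) ≤ 16 * #(compressibleMatrices (vecOf n y) k) := by
  have hfil (t : ℕ) : ((stringsLt (n * k + 1)).filter (compresses c (n, k) y t)).length =
      #((stringsLt (n * k + 1)).filter (compresses c (n, k) y t)).toFinset :=
    (List.toFinset_card_of_nodup ((nodup_stringsLt _).filter _)).symm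
  simp only [compressesMany, decide_eq_true_eq, exists_and_left, length_stringsLt, hfil]
  refine and_congr_right fun _ => ⟨?_, fun h => ?_⟩
  · rintro ⟨t, h⟩
    refine h.trans (Nat.mul_le_mul_left _ ((card_le_card fun a ha => ?_).trans
      (card_image_le (f := encM))))
    simp only [List.mem_toFinset, List.mem_filter, decide_eq_true_eq] at ha
    obtain ⟨A, rfl⟩ := encM_surjective (n := n) (k := k) ha.2.1
    exact mem_image_of_mem _ ((mem_compressibleMatrices_iff_compresses hc).2 ⟨t, ha.2⟩)
  · have ht (A : compressibleMatrices (vecOf n y) k) : ∃ t, compresses c (n, k) y t (encM A.1) :=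
      (mem_compressibleMatrices_iff_compresses hc).1 A.2
    choose t ht using ht
    refine ⟨univ.sup t, h.trans (Nat.mul_le_mul_left _ ?_)⟩
    refine card_le_card_of_injOn encM (fun A hA => ?_) encM_injective.injOn
    obtain ⟨hl, e, he, hev⟩ := ht ⟨A, hA⟩
    have hmono := Code.evaln_mono (le_sup (f := t) (mem_univ ⟨A, hA⟩)) hev
    simp only [List.coe_toFinset, List.mem_filter, Set.mem_ofPred_eq,
      decide_eq_true_eq, mem_stringsLt, length_encM]
    exact ⟨Nat.lt_succ_self _, length_encM A, e, he, hmono⟩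

theorem condC_condMachine_le
    (hc : ∀ e z : List Bool, z ∈ universal (e, []) ↔
      ∃ t, Code.evaln t c (Encodable.encode e) = some (Encodable.encode z))
    {y : List Bool} (hy : y.length = n) (hy1 : true ∈ y)
    (hN : 20 ≤ n * k + k) (h : 2 ^ (n * k) ≤ 16 * #(compressibleMatrices (vecOf n y) k)) :
    condC (condMachine c) y n.bits + 10 ≤ k := by
  classical
  obtain ⟨t, ht⟩ := (exists_compressesMany_iff hc).2 ⟨⟨hy, hy1⟩, h⟩
  let Y : Finset (Fin n → ZMod 2) := {v | v ≠ 0 ∧ 2 ^ (n * k) ≤ 16 * #(compressibleMatrices v k)}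
  have hY : #Y * 2 ^ 11 ≤ 2 ^ k := by
    refine card_frequently_mapped_le (compressible n k (n * k + k - 20)) Y ?_ fun v hv =>
      (mem_filter.1 hv).2.2
    rw [← pow_add]
    calc _ ≤ 2 ^ (n * k + k - 20) * 2 ^ 20 :=
          Nat.mul_le_mul_right _ (card_compressible_lt n k _).le
      _ = _ := by rw [← pow_add, Nat.sub_add_cancel hN]
  obtain ⟨i, hi, hmem⟩ := exists_lt_mem_enumerated (R := compressesMany c) ht (Y.image strOf)
    fun b s hb => by
      obtain ⟨⟨hl, hb1⟩, hb2⟩ := (exists_compressesMany_iff hc).1 ⟨s, hb⟩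
      exact mem_image.2 ⟨vecOf n b, mem_filter.2 ⟨mem_univ _, vecOf_ne_zero hl hb1, hb2⟩,
        strOf_vecOf hl⟩
  replace hi := hi.trans_le card_image_le
  have hk : 11 ≤ k := by
    refine (Nat.pow_le_pow_iff_right (a := 2) (by norm_num)).1 (le_trans ?_ hY)
    exact Nat.le_mul_of_pos_left _ (by omega)
  obtain ⟨r, rfl⟩ := Nat.exists_eq_add_of_le hk
  obtain ⟨d, hd, rfl⟩ := exists_value_eq (m := r) (i := i) (hi.trans_le (by
    rw [add_comm, pow_add] at hY
    exact Nat.le_of_mul_le_mul_right hY (by positivity)))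
  have : y ∈ condMachine c (false :: d, n.bits) := by
    simpa [condMachine, value_bits, hd, add_comm] using hmem
  refine (add_le_add_left (condC_le_length this) 10).trans (le_of_eq ?_)
  rw [List.length_cons, hd, add_comm 11 r]
  norm_cast

theorem card_goodA {y : List Bool}
    (hc : ∀ e z : List Bool, z ∈ universal (e, []) ↔
      ∃ t, Code.evaln t c (Encodable.encode e) = some (Encodable.encode z))
    (hp : (n + 1).Prime) (hy : y.length = n)
    (hk : (k : ℕ∞) = condC (condMachine c) y n.bits + 5) (hkn : k < n) :
    9 * 2 ^ (n * k) ≤ 10 * Nat.card {A : Matrix (Fin k) (Fin n) (ZMod 2) //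
      goodA (plainMachine c) (vecOf n y) A} := by
  classical
  obtain ⟨d, hd, hdl⟩ := exists_mem_of_condC_ne_top (V := condMachine c) (x := y) (y := n.bits)
    fun h => by simp [h] at hk
  have hkd : k = d.length + 5 := by rw [← hdl] at hk; exact_mod_cast hk
  have hN : 25 ≤ n * k := Nat.mul_le_mul (by omega : 5 ≤ n) (by omega : 5 ≤ k)
  set v := vecOf n y
  let Z : Finset (Matrix (Fin k) (Fin n) (ZMod 2)) :=
    {A | ∀ i, n * k + k - 9 ≤ i → (encM A ++ strOf (A.mulVec v)).getD i false = false}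
  let C := compressibleMatrices v k
  have hgood (A : Matrix (Fin k) (Fin n) (ZMod 2)) (hA : A ∉ Z ∪ C) :
      goodA (plainMachine c) v A := by
    rw [mem_union, not_or] at hA
    refine ⟨le_plainC fun u hu => ?_, plainC_lt_of_mem
      (mem_plainMachine_of_mem_condMachine hp hkn hd hkd A) ?_⟩
    · by_contra! hlt
      rcases mem_plainMachine hu with h | ⟨a, ha⟩
      · exact hA.2 (mem_compressibleMatrices.2 ⟨_, by rw [List.length_drop]; omega, h⟩)
      · refine hA.1 (mem_filter.2 ⟨mem_univ _, fun i hi => ?_⟩)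
        have hl := congrArg List.length ha
        simp only [List.length_append, length_encM, length_strOf, List.length_replicate] at hl
        rw [ha]
        exact getD_append_replicate_false (by omega)
    · rw [List.length_cons, List.length_append, length_encM]; omega
  have hcard : 2 ^ (n * k) ≤
      Nat.card {A : Matrix (Fin k) (Fin n) (ZMod 2) // goodA (plainMachine c) v A} +
        (#Z + #C) := by
    rw [Nat.card_eq_fintype_card, Fintype.card_subtype, ← card_matrix, ← card_univ]
    refine (card_le_card fun A _ => ?_).trans ((card_union_le _ (Z ∪ C)).trans
      (Nat.add_le_add_left (card_union_le _ _) _))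
    by_cases hA : A ∈ Z ∪ C
    · exact mem_union_right _ hA
    · exact mem_union_left _ (mem_filter.2 ⟨mem_univ _, hgood A hA⟩)
  suffices h : 10 * (#Z + #C) ≤ 2 ^ (n * k) by omega
  rcases eq_or_ne d [] with rfl | hd0
  · have hZ : #Z ≤ 2 ^ (n * k - 4) := by
      refine card_le_of_suffix_eq_zero encM_injective length_encM Z fun A hA i hi => ?_
      rcases lt_or_ge i (n * k) with hik | hik
      · have h := (mem_filter.1 hA).2 i (by simp at hkd; omega)
        rwa [List.getD_append _ _ _ _ (by rwa [length_encM])] at h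
      · simp [length_encM, hik]
    have hC : #C ≤ 2 ^ (n * k - 15) := (card_compressibleMatrices_lt v k).le.trans
      (Nat.pow_le_pow_right (by norm_num) (by simp at hkd; omega))
    obtain ⟨r, hr⟩ := Nat.exists_eq_add_of_le (hN.trans' (by norm_num : 15 ≤ 25))
    rw [hr, show 15 + r - 4 = 11 + r by omega, pow_add] at hZ
    rw [hr, Nat.add_sub_cancel_left] at hC
    rw [hr, pow_add]
    omega
  · have hk6 : 6 ≤ k := by have := List.length_pos_iff.2 hd0; omega
    have hy1 : true ∈ y := by
      by_contra hy0
      have hy0 : y = List.replicate n false :=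
        List.eq_replicate_iff.2 ⟨hy, fun b hb => by cases b; rfl; exact absurd hb hy0⟩
      have : y ∈ condMachine c ([], n.bits) := by simp [condMachine, value_bits, ← hy0]
      have := condC_le_length this
      rw [← hdl] at this
      have : d.length ≤ 0 := by exact_mod_cast this
      omega
    have hv0 : v ≠ 0 := vecOf_ne_zero hy hy1
    have hC : 16 * #C < 2 ^ (n * k) := by
      by_contra! h
      have := condC_condMachine_le hc hy hy1 (by omega) h
      rw [← hdl] at this
      have : d.length + 10 ≤ k := by exact_mod_cast this
      omega
    let F : Finset (Fin k → ZMod 2) := {f | ∀ i, k - 6 ≤ i → (strOf f).getD i false = false}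
    have hF : #F ≤ 2 ^ (k - 6) := card_le_of_suffix_eq_zero strOf_injective length_strOf F
      fun f hf => (mem_filter.1 hf).2
    have hZF : ∀ A ∈ Z, A.mulVec v ∈ F := fun A hA => mem_filter.2 ⟨mem_univ _, fun i hi => by
      have h := (mem_filter.1 hA).2 (n * k + i) (by omega)
      rwa [List.getD_append_right _ _ _ _ (by rw [length_encM]; omega), length_encM,
        Nat.add_sub_cancel_left] at h⟩
    have hZ : #Z * 2 ^ k ≤ 2 ^ (k - 6) * 2 ^ (n * k) := by
      rw [card_eq_sum_card_fiberwise hZF, sum_mul]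
      refine (sum_le_card_nsmul F _ (2 ^ (n * k)) fun f _ => ?_).trans
        (Nat.mul_le_mul_right _ hF)
      rw [← card_mulVec_eq hv0 f]
      exact Nat.mul_le_mul_right _ (card_le_card (filter_subset_filter _ (subset_univ _)))
    have hZ : 64 * #Z ≤ 2 ^ (n * k) := by
      refine Nat.le_of_mul_le_mul_left (c := 2 ^ (k - 6)) ?_ (by positivity)
      rwa [← mul_assoc, show 64 = 2 ^ 6 by rfl, ← pow_add, Nat.sub_add_cancel hk6, mul_comm]
    omega

end Counting

end KolmogorovXor

/-- Correctness, halting case: if `x ∈ H` has length `l`, `n = p_l - 1`,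
`y = x·0^(n-l)` and `k = C_V(y | n) + 5 < n`, then at least `9/10` of the `k × n`
binary matrices `A` satisfy `C_U(enc(A)·f) ≥ n·k + k` and
`C_U(enc(A)·f·0⁹) < n·k + k + 9`, where `f = A y`. -/
theorem correctness_halting_case :
    ∃ (V : List Bool × List Bool →. List Bool) (U : List Bool →. List Bool),
      CondUniversal V ∧ PlainUniversal U ∧
      ∀ (l : ℕ) (x : List Bool), x.length = l → Halts x →
        ∀ k : ℕ,
          (k : ℕ∞) = condC V
              (x ++ List.replicate (Nat.nth Nat.Prime l - 1 - l) false)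
              (Nat.bits (Nat.nth Nat.Prime l - 1)) + 5 →
          k < Nat.nth Nat.Prime l - 1 →
          9 * 2 ^ ((Nat.nth Nat.Prime l - 1) * k) ≤
            10 * Nat.card {A : Matrix (Fin k) (Fin (Nat.nth Nat.Prime l - 1)) (ZMod 2) //
              goodA U (vecOf (Nat.nth Nat.Prime l - 1)
                (x ++ List.replicate (Nat.nth Nat.Prime l - 1 - l) false)) A} := by
  obtain ⟨c, hc⟩ := KolmogorovXor.exists_code_universal
  refine ⟨KolmogorovXor.condMachine c, KolmogorovXor.plainMachine c,
    KolmogorovXor.condUniversal_condMachine c, KolmogorovXor.plainUniversal_plainMachine c,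
    fun l x hx _ k hk hkn => ?_⟩
  have hl := Nat.add_two_le_nth_prime l
  refine KolmogorovXor.card_goodA hc ?_ ?_ hk hkn
  · rw [Nat.sub_add_cancel (by omega)]
    exact Nat.prime_nth_prime l
  · rw [List.length_append, List.length_replicate, hx]
    omega
end
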